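/- Let ε > 0, n,m ∈ ℕ, γ ∈ [0,1/2), and let f ∈ F_ε. Then for all d_A, d_B ∈ ℕ, every unit vector ψ ∈ (ℂ²)^{⊗m} ⊗ ℂ^{d_A} ⊗ ℂ^{d_B}, and every family of POVMs {A^{xy}_a}_{a∈{0,1}^m} on ℂ^{d_A} and {B^{xy}_a}_{a∈{0,1}^m} on ℂ^{d_B} indexed by (x,y) ∈ {0,1}^n × {0,1}^n, one has 2^{−2n} · Σ_{x,y∈{0,1}^n} Σ_{a∈{0,1}^m} ⟨ψ, (M^{f(x,y)}_a ⊗ Σ_{a' : d_H(a,a') ≤ γm} A^{xy}_{a'} ⊗ B^{xy}_{a'}) ψ⟩ ≤ (λ_γ)^m · (1 + √(3·ln(2/ε)) · 2^{−n+m/2}). -/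

import Mathlib

open Matrix Kronecker Finset
open scoped ComplexOrder

noncomputable section

/-- Bit strings of length `n`. -/
abbrev Bits (n : ℕ) := Fin n → Bool

/-- Binary entropy function `h(p) = -p log₂ p - (1-p) log₂ (1-p)` (with `h 0 = 0`). -/
def binEnt (p : ℝ) : ℝ := -(p * Real.logb 2 p) - (1 - p) * Real.logb 2 (1 - p)

/-- `λ_γ = 2^{h(γ)} (1/2 + 1/(2√2))`. -/
def lamGamma (γ : ℝ) : ℝ := (2 : ℝ) ^ binEnt γ * (1 / 2 + 1 / (2 * Real.sqrt 2))

/-- Standard basis vector `|a⟩` of `ℂ²`. -/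
def ket (a : Bool) : Bool → ℂ := fun j => if j = a then 1 else 0

/-- The vector `H^z |a⟩` of `ℂ²`, where `H` is the 2×2 Hadamard matrix. -/
def hadVec (z a : Bool) : Bool → ℂ :=
  if z then fun j => (if j && a then (-1 : ℂ) else 1) / (Real.sqrt 2 : ℂ) else ket a

/-- The unit vector `⊗_{i} H^{z_i}|a_i⟩` of `(ℂ²)^{⊗ m}`. -/
def bb84Vec {m : ℕ} (z a : Bits m) : Bits m → ℂ := fun j => ∏ i, hadVec (z i) (a i) (j i)

/-- `M^z_a`: the rank-one orthogonal projector onto `⊗_i H^{z_i}|a_i⟩`. -/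
def Mproj {m : ℕ} (z a : Bits m) : Matrix (Bits m) (Bits m) ℂ :=
  vecMulVec (bb84Vec z a) (star (bb84Vec z a))

/-- A POVM: a family of positive semidefinite matrices summing to the identity. -/
def IsPOVM {d : Type*} [Fintype d] [DecidableEq d] {ι : Type*} [Fintype ι]
    (A : ι → Matrix d d ℂ) : Prop :=
  (∀ a, (A a).PosSemidef) ∧ ∑ a, A a = 1


/-- `q_f(z)`: the fraction of input pairs `(x,y)` mapped by `f` to `z`. -/
def qf (n m : ℕ) (f : Bits n × Bits n → Bits m) (z : Bits m) : ℝ :=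
  ((Finset.univ.filter (fun p : Bits n × Bits n => f p = z)).card : ℝ) / 2 ^ (2 * n)


section Core

variable {E : Type*} [NormedAddCommGroup E] [InnerProductSpace ℂ E]
  {ι κ J : Type*} [Fintype ι] [Nonempty ι] [Fintype κ] [Fintype J]

open scoped ComplexInnerProductSpace

lemma norm_inner_le_of_commute {P P' Q Q' : E →ₗ[ℂ] E} (hP' : P'.IsSymmetric) (hQ : Q.IsSymmetric)
    (hPQ : ∀ x, P (Q x) = Q (P x)) (hP'Q : ∀ x, P' (Q x) = Q (P' x)) (u u' : E) :
    ‖⟪P (Q u), P' (Q' u')⟫‖ ≤ (‖P' (P u)‖ ^ 2 + ‖Q (Q' u')‖ ^ 2) / 2 := by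
  have h : ⟪P (Q u), P' (Q' u')⟫ = ⟪P' (P u), Q (Q' u')⟫ := by
    rw [← hP', hPQ, hP'Q, hQ]
  have hsq := sq_nonneg (‖P' (P u)‖ - ‖Q (Q' u')‖)
  rw [h]
  refine (norm_inner_le_norm _ _).trans ?_
  linarith

/-- Overlap bound: if `P z` and `Q z` are commuting local measurements (given by square roots of
effects) and the vectors `v z a`, `v z' b` have overlaps at most `g z z'`, then the winning
operators sum to at most the largest row sum of `g`. -/
lemma sum_norm_sq_le_of_overlap (v : ι → κ → J → ℂ) (P Q : ι → κ → E →ₗ[ℂ] E)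
    (hP : ∀ z a, (P z a).IsSymmetric) (hQ : ∀ z a, (Q z a).IsSymmetric)
    (hPQ : ∀ z a z' b x, P z a (Q z' b x) = Q z' b (P z a x))
    (hPn : ∀ z x, ∑ a, ‖P z a x‖ ^ 2 = ‖x‖ ^ 2) (hQn : ∀ z x, ∑ a, ‖Q z a x‖ ^ 2 = ‖x‖ ^ 2)
    (g : ι → ι → ℝ) (hg : ∀ z z' a b, ‖∑ j, star (v z a j) * v z' b j‖ ≤ g z z')
    (hgs : ∀ z z', g z z' = g z' z) (hg0 : ∀ z z', 0 ≤ g z z')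
    (G : ℝ) (hG : ∀ z, ∑ z', g z z' = G)
    (ψ : J → E) (hψ : ∑ j, ‖ψ j‖ ^ 2 = 1) :
    ∑ z, ∑ a, ‖P z a (Q z a (∑ j, star (v z a j) • ψ j))‖ ^ 2 ≤ G := by
  set u : ι → κ → E := fun z a => P z a (Q z a (∑ j, star (v z a j) • ψ j)) with hu
  set N : ι → ℝ := fun z => ∑ a, ‖u z a‖ ^ 2 with hN
  set T : ℝ := ∑ z, N z with hT
  have hN0 : ∀ z, 0 ≤ N z := fun z => Finset.sum_nonneg fun a _ => by positivity
  have hT0 : 0 ≤ T := Finset.sum_nonneg fun z _ => hN0 z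
  have hPc : ∀ z a x, ‖P z a x‖ ^ 2 ≤ ‖x‖ ^ 2 := fun z a x => by
    rw [← hPn z x]
    exact Finset.single_le_sum (f := fun a => ‖P z a x‖ ^ 2) (fun i _ => by positivity)
      (Finset.mem_univ a)
  have hQc : ∀ z a x, ‖Q z a x‖ ^ 2 ≤ ‖x‖ ^ 2 := fun z a x => by
    rw [← hQn z x]
    exact Finset.single_le_sum (f := fun a => ‖Q z a x‖ ^ 2) (fun i _ => by positivity)
      (Finset.mem_univ a)
  let Φ : J → E := fun j => ∑ z, ∑ a, v z a j • P z a (Q z a (u z a))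
  have hTΦ : (T : ℂ) = ∑ j, ⟪Φ j, ψ j⟫ := by
    have h1 : ∀ z a, ((‖u z a‖ ^ 2 : ℝ) : ℂ)
        = ∑ j, ⟪v z a j • P z a (Q z a (u z a)), ψ j⟫ := fun z a => by
      have : ((‖u z a‖ ^ 2 : ℝ) : ℂ) = ⟪u z a, u z a⟫ := by
        rw [inner_self_eq_norm_sq_to_K]; norm_cast
      rw [this]
      conv_lhs => rw [hu]
      simp only
      rw [← hP, ← hQ, hPQ, inner_sum]
      refine Finset.sum_congr rfl fun j _ => ?_
      rw [inner_smul_right, inner_smul_left]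
      simp only [hu, hPQ]
      rfl
    simp only [hT, hN, Complex.ofReal_sum, h1, Φ, sum_inner]
    rw [Finset.sum_comm' (t' := Finset.univ) (s' := fun _ => Finset.univ) (by simp)]
    rw [Finset.sum_comm]
    conv_rhs => rw [Finset.sum_comm]
    refine Finset.sum_congr rfl fun z _ => ?_
    rw [Finset.sum_comm]
  have hΦ : ∑ j, ‖Φ j‖ ^ 2 ≤ G * T := by
    have h1 : ((∑ j, ‖Φ j‖ ^ 2 : ℝ) : ℂ) = ∑ z, ∑ z', ∑ a, ∑ b,
        (∑ j, star (v z a j) * v z' b j) *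
          ⟪P z a (Q z a (u z a)), P z' b (Q z' b (u z' b))⟫ := by
      have : ∀ j, ((‖Φ j‖ ^ 2 : ℝ) : ℂ) = ∑ z, ∑ z', ∑ a, ∑ b, star (v z a j) * v z' b j *
          ⟪P z a (Q z a (u z a)), P z' b (Q z' b (u z' b))⟫ := fun j => by
        have : ((‖Φ j‖ ^ 2 : ℝ) : ℂ) = ⟪Φ j, Φ j⟫ := by
          rw [inner_self_eq_norm_sq_to_K]; norm_cast
        rw [this]
        simp only [Φ, sum_inner]
        simp only [inner_sum, inner_smul_left, inner_smul_right]
        refine Finset.sum_congr rfl fun z _ => ?_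
        rw [Finset.sum_comm]
        refine Finset.sum_congr rfl fun z' _ => Finset.sum_congr rfl fun a _ =>
          Finset.sum_congr rfl fun b _ => ?_
        rw [starRingEnd_apply]; ring
      rw [Complex.ofReal_sum]
      simp only [this, Finset.sum_mul]
      rw [Finset.sum_comm]
      refine Finset.sum_congr rfl fun z _ => ?_
      rw [Finset.sum_comm]
      refine Finset.sum_congr rfl fun z' _ => ?_
      rw [Finset.sum_comm]
      refine Finset.sum_congr rfl fun a _ => ?_
      rw [Finset.sum_comm]
    have h2 : ∑ j, ‖Φ j‖ ^ 2 ≤ ∑ z, ∑ z', g z z' * ((N z + N z') / 2) := by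
      have h0 : (0 : ℝ) ≤ ∑ j, ‖Φ j‖ ^ 2 := Finset.sum_nonneg fun j _ => by positivity
      calc ∑ j, ‖Φ j‖ ^ 2 = ‖((∑ j, ‖Φ j‖ ^ 2 : ℝ) : ℂ)‖ := by
            rw [Complex.norm_real, Real.norm_of_nonneg h0]
        _ ≤ ∑ z, ∑ z', ∑ a, ∑ b, g z z' *
            ((‖P z' b (P z a (u z a))‖ ^ 2 + ‖Q z a (Q z' b (u z' b))‖ ^ 2) / 2) := by
          rw [h1]
          refine (norm_sum_le _ _).trans (Finset.sum_le_sum fun z _ => ?_)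
          refine (norm_sum_le _ _).trans (Finset.sum_le_sum fun z' _ => ?_)
          refine (norm_sum_le _ _).trans (Finset.sum_le_sum fun a _ => ?_)
          refine (norm_sum_le _ _).trans (Finset.sum_le_sum fun b _ => ?_)
          rw [norm_mul]
          exact mul_le_mul (hg z z' a b) (norm_inner_le_of_commute (hP _ _) (hQ _ _)
            (hPQ _ _ _ _) (hPQ _ _ _ _) _ _) (norm_nonneg _) (hg0 _ _)
        _ ≤ _ := by
          refine Finset.sum_le_sum fun z _ => Finset.sum_le_sum fun z' _ => ?_
          simp only [← Finset.mul_sum]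
          refine mul_le_mul_of_nonneg_left ?_ (hg0 _ _)
          simp only [← Finset.sum_div, Finset.sum_add_distrib]
          have e1 : ∑ a, ∑ b, ‖P z' b (P z a (u z a))‖ ^ 2 ≤ N z := by
            simp only [hPn, hN]
            exact Finset.sum_le_sum fun a _ => hPc _ _ _
          have e2 : ∑ a, ∑ b, ‖Q z a (Q z' b (u z' b))‖ ^ 2 ≤ N z' := by
            rw [Finset.sum_comm]
            simp only [hQn, hN]
            exact Finset.sum_le_sum fun a _ => hQc _ _ _
          linarith
    refine h2.trans (le_of_eq ?_)
    have e1 : ∑ z, ∑ z', g z z' * N z = G * T := by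
      simp only [← Finset.sum_mul, hG, ← Finset.mul_sum, hT]
    have e2 : ∑ z, ∑ z', g z z' * N z' = G * T := by
      rw [Finset.sum_comm]
      rw [← e1]
      refine Finset.sum_congr rfl fun z _ => Finset.sum_congr rfl fun z' _ => ?_
      rw [hgs]
    have e3 : ∑ z, ∑ z', g z z' * ((N z + N z') / 2)
        = (∑ z, ∑ z', g z z' * N z + ∑ z, ∑ z', g z z' * N z') / 2 := by
      simp only [← Finset.sum_add_distrib, Finset.sum_div]
      refine Finset.sum_congr rfl fun z _ => Finset.sum_congr rfl fun z' _ => by ring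
    rw [e3, e1, e2]; ring
  have hTle : T ≤ ∑ j, ‖Φ j‖ * ‖ψ j‖ := by
    calc T = ‖(T : ℂ)‖ := by rw [Complex.norm_real, Real.norm_of_nonneg hT0]
      _ ≤ _ := by
        rw [hTΦ]
        exact (norm_sum_le _ _).trans (Finset.sum_le_sum fun j _ => norm_inner_le_norm _ _)
  have hT2 : T ^ 2 ≤ G * T := by
    calc T ^ 2 ≤ (∑ j, ‖Φ j‖ * ‖ψ j‖) ^ 2 := by gcongr
      _ ≤ (∑ j, ‖Φ j‖ ^ 2) * ∑ j, ‖ψ j‖ ^ 2 := Finset.sum_mul_sq_le_sq_mul_sq _ _ _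
      _ ≤ G * T := by rw [hψ, mul_one]; exact hΦ
  rcases hT0.eq_or_lt with h | h
  · rw [← h, ← hG (Classical.arbitrary ι)]
    exact Finset.sum_nonneg fun z _ => hg0 _ _
  · nlinarith

end Core

section Overlap

lemma norm_sum_hadVec_le (z z' a b : Bool) :
    ‖∑ j, star (hadVec z a j) * hadVec z' b j‖ ≤ if z = z' then 1 else 1 / Real.sqrt 2 := by
  have h2 : ((Real.sqrt 2 : ℝ) : ℂ) * (Real.sqrt 2 : ℝ) = 2 := by
    rw [← Complex.ofReal_mul, Real.mul_self_sqrt (by norm_num)]; norm_num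
  have h4 : (((Real.sqrt 2 : ℝ) : ℂ))⁻¹ * ((Real.sqrt 2 : ℝ) : ℂ)⁻¹ = 1 / 2 := by
    rw [← mul_inv, h2]; norm_num
  cases z <;> cases z' <;> cases a <;> cases b <;>
    (simp [hadVec, ket, div_eq_mul_inv, h4, abs_of_nonneg]; try norm_num)

/-- Bound on the overlaps between the bases `z` and `z'`, namely `2 ^ (-d_H(z, z') / 2)`. -/
def overlapBound {m : ℕ} (z z' : Bits m) : ℝ := ∏ i, if z i = z' i then 1 else 1 / Real.sqrt 2

lemma overlapBound_comm {m : ℕ} (z z' : Bits m) : overlapBound z z' = overlapBound z' z := by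
  simp only [overlapBound, eq_comm]

lemma overlapBound_nonneg {m : ℕ} (z z' : Bits m) : 0 ≤ overlapBound z z' :=
  Finset.prod_nonneg fun i _ => by split_ifs <;> positivity

lemma sum_overlapBound {m : ℕ} (z : Bits m) :
    ∑ z', overlapBound z z' = (1 + 1 / Real.sqrt 2) ^ m := by
  have h := Finset.prod_univ_sum (fun _ : Fin m => (Finset.univ : Finset Bool))
    (fun i b => if z i = b then (1 : ℝ) else 1 / Real.sqrt 2)
  rw [Fintype.piFinset_univ] at h
  simp only [overlapBound]
  rw [← h]
  rw [Finset.prod_congr rfl (g := fun _ => 1 + 1 / Real.sqrt 2), Finset.prod_const,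
    Finset.card_univ, Fintype.card_fin]
  intro i _
  cases z i <;> simp [add_comm]

lemma norm_sum_bb84Vec_le {m : ℕ} (z z' a b : Bits m) :
    ‖∑ j, star (bb84Vec z a j) * bb84Vec z' b j‖ ≤ overlapBound z z' := by
  have h := Finset.prod_univ_sum (fun _ : Fin m => (Finset.univ : Finset Bool))
    (fun i j => star (hadVec (z i) (a i) j) * hadVec (z' i) (b i) j)
  rw [Fintype.piFinset_univ] at h
  simp only [bb84Vec, star_prod, ← Finset.prod_mul_distrib]
  rw [← h, norm_prod]
  exact Finset.prod_le_prod (fun _ _ => norm_nonneg _) fun i _ => norm_sum_hadVec_le _ _ _ _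

end Overlap

section Game

open scoped MatrixOrder in
lemma Matrix.PosSemidef.exists_isHermitian_mul_self {d : Type*} [Fintype d] [DecidableEq d]
    {A : Matrix d d ℂ} (h : A.PosSemidef) : ∃ X : Matrix d d ℂ, Xᴴ = X ∧ X * X = A :=
  ⟨CFC.sqrt A, (CFC.sqrt_nonneg A).isSelfAdjoint, CFC.sqrt_mul_sqrt_self A h.nonneg⟩

lemma norm_toEuclideanLin_sq {d : Type*} [Fintype d] [DecidableEq d] (K : Matrix d d ℂ)
    (x : d → ℂ) : ((‖toEuclideanLin K (WithLp.toLp 2 x)‖ ^ 2 : ℝ) : ℂ)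
      = star x ⬝ᵥ ((Kᴴ * K) *ᵥ x) := by
  rw [← Matrix.mulVec_mulVec, Matrix.dotProduct_mulVec, ← Matrix.star_mulVec]
  simp [EuclideanSpace.norm_sq_eq, dotProduct, Matrix.toLpLin_apply, Complex.conj_mul']

lemma sum_norm_toEuclideanLin_sq {d ι : Type*} [Fintype d] [DecidableEq d] [Fintype ι]
    (X : ι → Matrix d d ℂ) (hX : ∀ a, (X a)ᴴ = X a) (hX1 : ∑ a, X a * X a = 1)
    (x : EuclideanSpace ℂ d) : ∑ a, ‖toEuclideanLin (X a) x‖ ^ 2 = ‖x‖ ^ 2 := by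
  have h1 : ∀ K : Matrix d d ℂ, ((‖toEuclideanLin K x‖ ^ 2 : ℝ) : ℂ)
      = star x.ofLp ⬝ᵥ ((Kᴴ * K) *ᵥ x.ofLp) := fun K => norm_toEuclideanLin_sq K x.ofLp
  have h2 := h1 1
  have h3 : toEuclideanLin (1 : Matrix d d ℂ) x = x := by simp
  rw [h3] at h2
  apply Complex.ofReal_injective
  rw [Complex.ofReal_sum, h2]
  simp only [h1, hX, Matrix.conjTranspose_one, one_mul]
  rw [← dotProduct_sum, ← Matrix.sum_mulVec, hX1]

lemma dotProduct_vecMulVec_kronecker_mulVec {J D : Type*} [Fintype J] [Fintype D] (v : J → ℂ)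
    (C : Matrix D D ℂ) (ψ : J × D → ℂ) :
    star ψ ⬝ᵥ ((vecMulVec v (star v) ⊗ₖ C) *ᵥ ψ)
      = star (fun d => ∑ j, star (v j) * ψ (j, d)) ⬝ᵥ
        (C *ᵥ (fun d => ∑ j, star (v j) * ψ (j, d))) := by
  simp only [dotProduct, Matrix.mulVec, Fintype.sum_prod_type, Matrix.kroneckerMap_apply,
    vecMulVec_apply, Pi.star_apply, star_sum, star_mul', star_star]
  rw [Finset.sum_comm]
  refine Finset.sum_congr rfl fun d _ => ?_
  rw [Finset.sum_mul]
  refine Finset.sum_congr rfl fun j _ => ?_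
  rw [Finset.sum_comm]
  simp only [Finset.mul_sum]
  refine Finset.sum_congr rfl fun d' _ => Finset.sum_congr rfl fun j' _ => ?_
  ring

lemma isSymmetric_toEuclideanLin {d : Type*} [Fintype d] [DecidableEq d] {K : Matrix d d ℂ}
    (hK : Kᴴ = K) : (toEuclideanLin K).IsSymmetric :=
  Matrix.isSymmetric_toEuclideanLin_iff.mpr hK

variable {m : ℕ} {DA DB : Type*} [Fintype DA] [Fintype DB] [DecidableEq DA] [DecidableEq DB]

/-- The parallel BB84 monogamy game: two parties who both know the basis `z` before measuring
cannot guess all outcomes with average probability above `(1/2 + 1/(2√2)) ^ m`. -/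
lemma monogamy_game_le (ψ : Bits m × DA × DB → ℂ) (hψ : ∑ i, ‖ψ i‖ ^ 2 = 1)
    (A : Bits m → Bits m → Matrix DA DA ℂ) (B : Bits m → Bits m → Matrix DB DB ℂ)
    (hA : ∀ z, IsPOVM (A z)) (hB : ∀ z, IsPOVM (B z)) :
    ∑ z, ∑ a, (star ψ ⬝ᵥ ((Mproj z a ⊗ₖ (A z a ⊗ₖ B z a)) *ᵥ ψ)).re
      ≤ (1 + 1 / Real.sqrt 2) ^ m := by
  choose X hX hXA using fun z a => ((hA z).1 a).exists_isHermitian_mul_self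
  choose Y hY hYB using fun z a => ((hB z).1 a).exists_isHermitian_mul_self
  have hX' : ∀ z a, (X z a ⊗ₖ (1 : Matrix DB DB ℂ))ᴴ = X z a ⊗ₖ (1 : Matrix DB DB ℂ) := by
    intro z a; rw [Matrix.conjTranspose_kronecker, hX, Matrix.conjTranspose_one]
  have hY' : ∀ z a, ((1 : Matrix DA DA ℂ) ⊗ₖ Y z a)ᴴ = (1 : Matrix DA DA ℂ) ⊗ₖ Y z a := by
    intro z a; rw [Matrix.conjTranspose_kronecker, hY, Matrix.conjTranspose_one]
  have key := sum_norm_sq_le_of_overlap (E := EuclideanSpace ℂ (DA × DB))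
    (fun z a : Bits m => bb84Vec z a)
    (fun z a => toEuclideanLin (X z a ⊗ₖ (1 : Matrix DB DB ℂ)))
    (fun z a => toEuclideanLin ((1 : Matrix DA DA ℂ) ⊗ₖ Y z a))
    (fun z a => isSymmetric_toEuclideanLin (hX' z a))
    (fun z a => isSymmetric_toEuclideanLin (hY' z a))
    (fun z a z' b x => by
      simp [Matrix.toLpLin_apply, Matrix.mulVec_mulVec, ← Matrix.mul_kronecker_mul])
    (fun z x => sum_norm_toEuclideanLin_sq _ (hX' z) (by
      simp only [← Matrix.mul_kronecker_mul, hXA, mul_one]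
      rw [← Matrix.one_kronecker_one, ← (hA z).2]
      ext i j
      simp [Matrix.sum_apply, Matrix.kroneckerMap_apply, Finset.sum_mul]) x)
    (fun z x => sum_norm_toEuclideanLin_sq _ (hY' z) (by
      simp only [← Matrix.mul_kronecker_mul, hYB, mul_one]
      rw [← Matrix.one_kronecker_one, ← (hB z).2]
      ext i j
      simp [Matrix.sum_apply, Matrix.kroneckerMap_apply, Finset.mul_sum]) x)
    overlapBound norm_sum_bb84Vec_le overlapBound_comm overlapBound_nonneg
    _ sum_overlapBound (fun j => WithLp.toLp 2 fun d => ψ (j, d))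
    (by simpa [EuclideanSpace.norm_sq_eq, Fintype.sum_prod_type] using hψ)
  refine le_of_eq_of_le ?_ key
  refine Finset.sum_congr rfl fun z _ => Finset.sum_congr rfl fun a _ => ?_
  have e1 : (∑ j, star (bb84Vec z a j) • WithLp.toLp 2 fun d => ψ (j, d))
      = WithLp.toLp 2 (fun d => ∑ j, star (bb84Vec z a j) * ψ (j, d)) := by
    ext d; simp
  have e2 : A z a ⊗ₖ B z a = (X z a ⊗ₖ Y z a)ᴴ * (X z a ⊗ₖ Y z a) := by
    rw [Matrix.conjTranspose_kronecker, hX, hY, ← Matrix.mul_kronecker_mul, hXA, hYB]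
  have e3 : ∀ x : DA × DB → ℂ, toEuclideanLin (X z a ⊗ₖ (1 : Matrix DB DB ℂ))
      (toEuclideanLin ((1 : Matrix DA DA ℂ) ⊗ₖ Y z a) (WithLp.toLp 2 x))
      = toEuclideanLin (X z a ⊗ₖ Y z a) (WithLp.toLp 2 x) := fun x => by
    simp [Matrix.toLpLin_apply, Matrix.mulVec_mulVec, ← Matrix.mul_kronecker_mul]
  rw [Mproj, dotProduct_vecMulVec_kronecker_mulVec, e2, ← norm_toEuclideanLin_sq, e1, e3,
    Complex.ofReal_re]

end Game

section HammingBall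

lemma card_hammingBall_le (m : ℕ) {γ : ℝ} (hγ0 : 0 ≤ γ) (hγ1 : γ < 1 / 2) :
    ((Finset.univ.filter
        (fun e : Bits m => (hammingDist (fun _ => false) e : ℝ) ≤ γ * m)).card : ℝ)
      ≤ ((2 : ℝ) ^ binEnt γ) ^ m := by
  rcases hγ0.eq_or_lt with rfl | hγ
  · have : (Finset.univ.filter
        (fun e : Bits m => (hammingDist (fun _ => false) e : ℝ) ≤ 0 * m)).card ≤ 1 := by
      refine Finset.card_le_one.mpr fun a ha b hb => ?_
      simp only [zero_mul, Finset.mem_filter, Finset.mem_univ, true_and, Nat.cast_nonpos,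
        hammingDist_eq_zero] at ha hb
      rw [← ha, ← hb]
    simpa [binEnt] using this
  have h1 : 0 < 1 - γ := by linarith
  have hlog : Real.log γ - Real.log (1 - γ) ≤ 0 :=
    sub_nonpos.mpr (Real.log_le_log hγ (by linarith))
  have hH : ((2 : ℝ) ^ binEnt γ) ^ m
      = Real.exp (-(γ * m * Real.log γ + (1 - γ) * m * Real.log (1 - γ))) := by
    rw [← Real.rpow_natCast, ← Real.rpow_mul (by norm_num), Real.rpow_def_of_pos (by norm_num)]
    congr 1
    have : Real.log 2 ≠ 0 := (Real.log_pos (by norm_num)).ne'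
    simp only [binEnt, Real.logb]
    field_simp
    ring
  have hone : ∑ e : Bits m, ∏ i, (if e i then γ else 1 - γ) = 1 := by
    have h := Finset.prod_univ_sum (fun _ : Fin m => (Finset.univ : Finset Bool))
      (fun _ b => if b then γ else 1 - γ)
    rw [Fintype.piFinset_univ] at h
    rw [← h]
    simp
  have hle : ∀ e : Bits m, (hammingDist (fun _ => false) e : ℝ) ≤ γ * m →
      Real.exp (γ * m * Real.log γ + (1 - γ) * m * Real.log (1 - γ))
        ≤ ∏ i, (if e i then γ else 1 - γ) := by
    intro e he
    have hk : (hammingDist (fun _ => false) e : ℝ) = ∑ i, if e i then (1 : ℝ) else 0 := by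
      simp [hammingDist]
    have hprod : ∏ i, (if e i then γ else 1 - γ) = Real.exp (m * Real.log (1 - γ)
        + hammingDist (fun _ => false) e * (Real.log γ - Real.log (1 - γ))) := by
      have : (m : ℝ) * Real.log (1 - γ) = ∑ _i : Fin m, Real.log (1 - γ) := by simp
      rw [hk, Finset.sum_mul, this, ← Finset.sum_add_distrib, Real.exp_sum]
      refine Finset.prod_congr rfl fun i _ => ?_
      split_ifs
      · rw [one_mul, add_sub_cancel, Real.exp_log hγ]
      · rw [zero_mul, add_zero, Real.exp_log h1]
    rw [hprod, Real.exp_le_exp]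
    nlinarith
  rw [hH, Real.exp_neg, ← one_div, le_div_iff₀ (Real.exp_pos _), ← nsmul_eq_mul,
    ← Finset.sum_const]
  refine le_of_le_of_eq ?_ hone
  refine (Finset.sum_le_sum fun e he => hle e (Finset.mem_filter.mp he).2).trans ?_
  exact Finset.sum_le_sum_of_subset_of_nonneg (Finset.filter_subset _ _) fun e _ _ =>
    Finset.prod_nonneg fun i _ => by split_ifs <;> linarith

/-- Translation of bit strings by `e`. -/
def xorEquiv {m : ℕ} (e : Bits m) : Bits m ≃ Bits m :=
  Function.Involutive.toPerm (fun a i => xor (e i) (a i)) fun a => by ext i; simp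

lemma xorEquiv_apply {m : ℕ} (e a : Bits m) (i : Fin m) : xorEquiv e a i = xor (e i) (a i) := rfl

lemma sum_sum_hammingBall {m : ℕ} (r : ℝ) (F : Bits m → Bits m → ℝ) :
    ∑ a, ∑ a' ∈ Finset.univ.filter (fun a' : Bits m => (hammingDist a a' : ℝ) ≤ r), F a a'
      = ∑ e ∈ Finset.univ.filter
          (fun e : Bits m => (hammingDist (fun _ => false) e : ℝ) ≤ r),
        ∑ a, F a (xorEquiv e a) := by
  rw [Finset.sum_comm]
  refine Finset.sum_congr rfl fun a _ => ?_
  simp only [Finset.sum_filter]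
  refine (Equiv.sum_comp (xorEquiv a) _).symm.trans (Finset.sum_congr rfl fun e _ => ?_)
  have h1 : xorEquiv a e = xorEquiv e a := by
    ext i; rw [xorEquiv_apply, xorEquiv_apply, Bool.xor_comm]
  have h2 : hammingDist a (xorEquiv e a) = hammingDist (fun _ => false) e := by
    simp only [hammingDist, xorEquiv_apply]
    congr 1
    refine Finset.filter_congr fun i _ => ?_
    cases a i <;> cases e i <;> simp
  rw [h1, h2]

end HammingBall

section NoisyGame

variable {m : ℕ} {DA DB : Type*} [Fintype DA] [Fintype DB]

/-- Probability that both answers coincide and lie within distance `r` of the outcome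
of the measurement in basis `z`. -/
def noisyWin (ψ : Bits m × DA × DB → ℂ) (r : ℝ) (z : Bits m) (A : Bits m → Matrix DA DA ℂ)
    (B : Bits m → Matrix DB DB ℂ) : ℝ :=
  ∑ a : Bits m, (star ψ ⬝ᵥ ((Mproj z a ⊗ₖ
    (∑ a' ∈ Finset.univ.filter (fun a' : Bits m => (hammingDist a a' : ℝ) ≤ r),
      A a' ⊗ₖ B a')).mulVec ψ)).re

lemma noisyWin_eq (ψ : Bits m × DA × DB → ℂ) (r : ℝ) (z : Bits m)
    (A : Bits m → Matrix DA DA ℂ) (B : Bits m → Matrix DB DB ℂ) :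
    noisyWin ψ r z A B = ∑ e ∈ Finset.univ.filter
          (fun e : Bits m => (hammingDist (fun _ => false) e : ℝ) ≤ r),
      ∑ a, (star ψ ⬝ᵥ ((Mproj z a ⊗ₖ
        (A (xorEquiv e a) ⊗ₖ B (xorEquiv e a))) *ᵥ ψ)).re := by
  rw [← sum_sum_hammingBall r
    fun a a' => (star ψ ⬝ᵥ ((Mproj z a ⊗ₖ (A a' ⊗ₖ B a')) *ᵥ ψ)).re]
  refine Finset.sum_congr rfl fun a _ => ?_
  have h : Mproj z a ⊗ₖ
    (∑ a' ∈ Finset.univ.filter (fun a' : Bits m => (hammingDist a a' : ℝ) ≤ r), A a' ⊗ₖ B a')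
      = ∑ a' ∈ Finset.univ.filter (fun a' : Bits m => (hammingDist a a' : ℝ) ≤ r),
        Mproj z a ⊗ₖ (A a' ⊗ₖ B a') := by
    ext i j
    simp [Matrix.sum_apply, Matrix.kroneckerMap_apply, Finset.mul_sum]
  rw [h, Matrix.sum_mulVec, dotProduct_sum, Complex.re_sum]

variable [DecidableEq DA] [DecidableEq DB]

lemma noisyWin_nonneg (ψ : Bits m × DA × DB → ℂ) (r : ℝ) (z : Bits m)
    {A : Bits m → Matrix DA DA ℂ} {B : Bits m → Matrix DB DB ℂ} (hA : IsPOVM A) (hB : IsPOVM B) :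
    0 ≤ noisyWin ψ r z A B := by
  refine Finset.sum_nonneg fun a _ => ?_
  have h : (Mproj z a ⊗ₖ
    (∑ a' ∈ Finset.univ.filter (fun a' : Bits m => (hammingDist a a' : ℝ) ≤ r),
      A a' ⊗ₖ B a')).PosSemidef :=
    (Matrix.posSemidef_vecMulVec_self_star _).kronecker
      (Matrix.posSemidef_sum _ fun a' _ => (hA.1 a').kronecker (hB.1 a'))
  exact (Complex.le_def.mp (h.dotProduct_mulVec_nonneg ψ)).1

lemma IsPOVM.comp_equiv {d ι : Type*} [Fintype d] [DecidableEq d] [Fintype ι]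
    {A : ι → Matrix d d ℂ} (hA : IsPOVM A) (σ : ι ≃ ι) : IsPOVM fun a => A (σ a) :=
  ⟨fun _ => hA.1 _, (Equiv.sum_comp σ A).trans hA.2⟩

lemma sum_noisyWin_le (ψ : Bits m × DA × DB → ℂ) (hψ : ∑ i, ‖ψ i‖ ^ 2 = 1)
    {γ : ℝ} (hγ0 : 0 ≤ γ) (hγ1 : γ < 1 / 2)
    (A : Bits m → Bits m → Matrix DA DA ℂ) (B : Bits m → Bits m → Matrix DB DB ℂ)
    (hA : ∀ z, IsPOVM (A z)) (hB : ∀ z, IsPOVM (B z)) :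
    ∑ z, noisyWin ψ (γ * m) z (A z) (B z) ≤ 2 ^ m * lamGamma γ ^ m := by
  simp only [noisyWin_eq]
  rw [Finset.sum_comm]
  calc _ ≤ ∑ e ∈ Finset.univ.filter
          (fun e : Bits m => (hammingDist (fun _ => false) e : ℝ) ≤ γ * m),
          (1 + 1 / Real.sqrt 2) ^ m :=
        Finset.sum_le_sum fun e _ => monogamy_game_le ψ hψ _ _
          (fun z => (hA z).comp_equiv (xorEquiv e)) (fun z => (hB z).comp_equiv (xorEquiv e))
    _ ≤ ((2 : ℝ) ^ binEnt γ) ^ m * (1 + 1 / Real.sqrt 2) ^ m := by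
        rw [Finset.sum_const, nsmul_eq_mul]
        exact mul_le_mul_of_nonneg_right (card_hammingBall_le m hγ0 hγ1) (by positivity)
    _ = 2 ^ m * lamGamma γ ^ m := by
        rw [← mul_pow, ← mul_pow, lamGamma]
        congr 1
        field_simp

end NoisyGame

/-- bound on the fixed-state attack probability for functions in `F_ε`. -/
theorem stmt2 (ε : ℝ) (hε : 0 < ε) (n m : ℕ) (γ : ℝ) (hγ0 : 0 ≤ γ) (hγ1 : γ < 1 / 2)
    (f : Bits n × Bits n → Bits m)
    (hf : ∀ z : Bits m,
      |qf n m f z - (2 : ℝ) ^ (-(m : ℝ))| ≤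
        Real.sqrt (3 * Real.log (2 / ε)) * (2 : ℝ) ^ (-(n : ℝ) - m / 2))
    (dA dB : ℕ)
    (ψ : Bits m × Fin dA × Fin dB → ℂ) (hψ : ∑ i, ‖ψ i‖ ^ 2 = 1)
    (A : Bits n → Bits n → Bits m → Matrix (Fin dA) (Fin dA) ℂ)
    (B : Bits n → Bits n → Bits m → Matrix (Fin dB) (Fin dB) ℂ)
    (hA : ∀ x y, IsPOVM (A x y)) (hB : ∀ x y, IsPOVM (B x y)) :
    (1 / 2 ^ (2 * n) : ℝ) * ∑ x : Bits n, ∑ y : Bits n, ∑ a : Bits m,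
      (star ψ ⬝ᵥ ((Mproj (f (x, y)) a ⊗ₖ
          (∑ a' ∈ Finset.univ.filter
              (fun a' : Bits m => (hammingDist a a' : ℝ) ≤ γ * m),
            A x y a' ⊗ₖ B x y a')).mulVec ψ)).re
      ≤ lamGamma γ ^ m *
          (1 + Real.sqrt (3 * Real.log (2 / ε)) * (2 : ℝ) ^ (-(n : ℝ) + m / 2)) := by
  set D : ℝ := Real.sqrt (3 * Real.log (2 / ε)) with hD
  have hmax : ∀ z : Bits m, ∃ p : Bits n × Bits n, ∀ p' : Bits n × Bits n,
      noisyWin ψ (γ * m) z (A p'.1 p'.2) (B p'.1 p'.2)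
        ≤ noisyWin ψ (γ * m) z (A p.1 p.2) (B p.1 p.2) := fun z =>
    Finite.exists_max fun p : Bits n × Bits n =>
      noisyWin ψ (γ * m) z (A p.1 p.2) (B p.1 p.2)
  choose p hp using hmax
  set W : Bits m → ℝ := fun z =>
    noisyWin ψ (γ * m) z (A (p z).1 (p z).2) (B (p z).1 (p z).2) with hW
  have hW0 : ∀ z, 0 ≤ W z := fun z => noisyWin_nonneg ψ _ z (hA _ _) (hB _ _)
  have hWsum : ∑ z, W z ≤ 2 ^ m * lamGamma γ ^ m :=
    sum_noisyWin_le ψ hψ hγ0 hγ1 (fun z => A (p z).1 (p z).2) (fun z => B (p z).1 (p z).2)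
      (fun z => hA _ _) (fun z => hB _ _)
  have hfib : ∑ q : Bits n × Bits n, W (f q)
      = ∑ z, ((Finset.univ.filter (fun q => f q = z)).card : ℝ) * W z := by
    rw [← Finset.sum_fiberwise Finset.univ f]
    refine Finset.sum_congr rfl fun z _ => ?_
    rw [Finset.sum_congr rfl fun q hq => by rw [(Finset.mem_filter.mp hq).2],
      Finset.sum_const, nsmul_eq_mul]
  calc (1 / 2 ^ (2 * n) : ℝ) * ∑ x : Bits n, ∑ y : Bits n,
        noisyWin ψ (γ * m) (f (x, y)) (A x y) (B x y)
      ≤ (1 / 2 ^ (2 * n) : ℝ) * ∑ q : Bits n × Bits n, W (f q) := by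
        rw [← Fintype.sum_prod_type'
          (f := fun x y => noisyWin ψ (γ * m) (f (x, y)) (A x y) (B x y))]
        exact mul_le_mul_of_nonneg_left (Finset.sum_le_sum fun q _ => hp (f q) q) (by positivity)
    _ = ∑ z, qf n m f z * W z := by
        rw [hfib, Finset.mul_sum]
        refine Finset.sum_congr rfl fun z _ => ?_
        rw [qf]; ring
    _ ≤ ∑ z, ((2 : ℝ) ^ (-(m : ℝ)) + D * (2 : ℝ) ^ (-(n : ℝ) - m / 2)) * W z := by
        refine Finset.sum_le_sum fun z _ => mul_le_mul_of_nonneg_right ?_ (hW0 z)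
        linarith [(abs_le.mp (hf z)).2]
    _ ≤ ((2 : ℝ) ^ (-(m : ℝ)) + D * (2 : ℝ) ^ (-(n : ℝ) - m / 2)) *
          (2 ^ m * lamGamma γ ^ m) := by
        rw [← Finset.mul_sum]
        exact mul_le_mul_of_nonneg_left hWsum (by positivity)
    _ = lamGamma γ ^ m * (1 + D * (2 : ℝ) ^ (-(n : ℝ) + m / 2)) := by
        have e1 : (2 : ℝ) ^ (-(m : ℝ)) * 2 ^ m = 1 := by
          rw [← Real.rpow_natCast, ← Real.rpow_add (by norm_num), neg_add_cancel, Real.rpow_zero]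
        have e2 : (2 : ℝ) ^ (-(n : ℝ) - m / 2) * 2 ^ m = (2 : ℝ) ^ (-(n : ℝ) + m / 2) := by
          rw [← Real.rpow_natCast, ← Real.rpow_add (by norm_num)]
          congr 1; ring
        rw [← e1, ← e2]; ring
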